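/- arXiv:1002.4449 — 4 statements merged into one kernel-verified Lean document; each statement's English description precedes it below -/
import Mathlib

section
/- Let n ≥ 1 and let T be a linear map from the space Sym_n(ℝ) of real symmetric n×n matrices to itself such that T(D * A * Dᵀ) = D * (T A) * Dᵀ for every matrix D in the orthogonal group O(n) and every A ∈ Sym_n(ℝ). Then there exist real constants κ and λ such that T A = κ • A + λ • (trace A) • (1 : Matrix) for every A ∈ Sym_n(ℝ). -/
open Matrix

/-- The submodule of symmetric `n × n` real matrices. -/
def SymMat (n : ℕ) : Submodule ℝ (Matrix (Fin n) (Fin n) ℝ) where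
  carrier := {A | A.IsSymm}
  add_mem' := fun {a b} ha hb => by
    simp only [Set.mem_setOf_eq, Matrix.IsSymm, Matrix.transpose_add] at *
    rw [ha, hb]
  zero_mem' := by simp [Matrix.IsSymm]
  smul_mem' := fun c A hA => by
    simp only [Set.mem_setOf_eq, Matrix.IsSymm, Matrix.transpose_smul] at *
    rw [hA]

/-- A two-point function invariant under all permutations is constant on the diagonal and constant
off the diagonal. -/
lemma exists_eq_ite_of_perm_invariant {α R : Type*} [DecidableEq α] [AddCommGroup R]
    (M : α → α → R) (hM : ∀ (σ : Equiv.Perm α) (i j : α), M (σ i) (σ j) = M i j) :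
    ∃ a b : R, ∀ i j, M i j = (if i = j then a else 0) + b := by
  by_cases h : ∃ p q : α, p ≠ q
  · obtain ⟨p, q, hpq⟩ := h
    refine ⟨M p p - M p q, M p q, fun i j => ?_⟩
    split_ifs with hij
    · subst hij
      simpa using hM (Equiv.swap p i) p p
    · have hq : i ≠ Equiv.swap p i q := by
        intro h
        apply hpq
        apply (Equiv.swap p i).injective
        rw [← h, Equiv.swap_apply_left]
      have := hM (Equiv.swap (Equiv.swap p i q) j * Equiv.swap p i) p q
      rw [Equiv.Perm.mul_apply, Equiv.Perm.mul_apply, Equiv.swap_apply_left,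
        Equiv.swap_apply_left, Equiv.swap_apply_of_ne_of_ne hq hij] at this
      rw [this, zero_add]
  · push Not at h
    rcases isEmpty_or_nonempty α with hα | ⟨⟨p⟩⟩
    · exact ⟨0, 0, fun i => isEmptyElim i⟩
    · refine ⟨M p p, 0, fun i j => ?_⟩
      rw [h i p, h j p]
      simp

/-- Diagonal matrices, as a linear map into the symmetric matrices. -/
def diagonalSymMat (n : ℕ) : (Fin n → ℝ) →ₗ[ℝ] SymMat n :=
  (Matrix.diagonalLinearMap (Fin n) ℝ ℝ).codRestrict (SymMat n)
    fun d => Matrix.isSymm_diagonal d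

@[simp]
lemma coe_diagonalSymMat {n : ℕ} (d : Fin n → ℝ) :
    (diagonalSymMat n d : Matrix (Fin n) (Fin n) ℝ) = Matrix.diagonal d := rfl

/-- Conjugation by a permutation matrix permutes rows and columns. -/
lemma submatrix_one_mul_mul_transpose {n : ℕ} (σ : Equiv.Perm (Fin n))
    (A : Matrix (Fin n) (Fin n) ℝ) :
    (1 : Matrix (Fin n) (Fin n) ℝ).submatrix σ id * A *
      ((1 : Matrix (Fin n) (Fin n) ℝ).submatrix σ id)ᵀ = A.submatrix σ σ := by
  ext i j
  simp [Matrix.mul_apply, Matrix.one_apply]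

/-- A matrix fixed by all sign changes of the coordinates is diagonal. -/
lemma apply_eq_zero_of_conj_diagonal_eq {n : ℕ} {X : Matrix (Fin n) (Fin n) ℝ}
    (hX : ∀ s : Fin n → ℝ, (∀ i, s i * s i = 1) →
      X = Matrix.diagonal s * X * (Matrix.diagonal s)ᵀ)
    {i j : Fin n} (hij : i ≠ j) : X i j = 0 := by
  have h := congrFun₂ (hX (fun k => if k = i then -1 else 1) fun k => by split_ifs <;> norm_num) i j
  rw [Matrix.diagonal_transpose, Matrix.mul_diagonal, Matrix.diagonal_mul, if_pos rfl,
    if_neg hij.symm] at h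
  linarith

/-- An `O(n)`-equivariant map has the form `κ A + λ (tr A) 1` on diagonal matrices. -/
lemma exists_apply_diagonalSymMat {n : ℕ} (T : SymMat n →ₗ[ℝ] SymMat n)
    (hT : ∀ D : Matrix (Fin n) (Fin n) ℝ, D ∈ Matrix.orthogonalGroup (Fin n) ℝ →
      ∀ A B : SymMat n, (B : Matrix (Fin n) (Fin n) ℝ) = D * (A : Matrix (Fin n) (Fin n) ℝ) * Dᵀ →
        (T B : Matrix (Fin n) (Fin n) ℝ) = D * (T A : Matrix (Fin n) (Fin n) ℝ) * Dᵀ) :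
    ∃ κ lam : ℝ, ∀ d : Fin n → ℝ,
      (T (diagonalSymMat n d) : Matrix (Fin n) (Fin n) ℝ) =
        κ • Matrix.diagonal d + lam • ((∑ i, d i) • (1 : Matrix (Fin n) (Fin n) ℝ)) := by
  have hperm (σ : Equiv.Perm (Fin n)) (d : Fin n → ℝ) :
      (T (diagonalSymMat n (d ∘ σ)) : Matrix (Fin n) (Fin n) ℝ) =
        (T (diagonalSymMat n d) : Matrix (Fin n) (Fin n) ℝ).submatrix σ σ := by
    rw [← submatrix_one_mul_mul_transpose]
    refine hT _ ?_ _ _ ?_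
    · have h := submatrix_one_mul_mul_transpose σ 1
      rw [mul_one, Matrix.submatrix_one_equiv] at h
      exact (Matrix.mem_orthogonalGroup_iff _ _).2 h
    · rw [submatrix_one_mul_mul_transpose]
      exact (Matrix.submatrix_diagonal_equiv d σ).symm
  obtain ⟨κ, lam, hM⟩ := exists_eq_ite_of_perm_invariant
    (fun i j => (T (diagonalSymMat n (fun k => if i = k then 1 else 0)) :
      Matrix (Fin n) (Fin n) ℝ) j j) fun σ i j => by
    have h := congrFun₂ (hperm σ fun k => if σ i = k then 1 else 0) j j
    simpa [Function.comp_def] using h.symm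
  refine ⟨κ, lam, fun d => ?_⟩
  ext i j
  by_cases hij : i = j
  · subst hij
    have h := LinearMap.pi_apply_eq_sum_univ
      (Matrix.entryLinearMap ℝ ℝ i i ∘ₗ (SymMat n).subtype ∘ₗ T ∘ₗ diagonalSymMat n) d
    simp only [LinearMap.comp_apply, Submodule.subtype_apply, Matrix.entryLinearMap_apply,
      hM] at h
    simp [h, mul_add, Finset.sum_add_distrib, Finset.mul_sum, mul_comm]
  · rw [apply_eq_zero_of_conj_diagonal_eq (fun s hs => hT _ ?_ _ _ ?_) hij]
    · simp [hij]
    · simp [Matrix.mem_orthogonalGroup_iff, hs]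
    · have hd (k : Fin n) : s k * d k * s k = d k := by rw [mul_right_comm, hs, one_mul]
      simp [hd]

/-- If `T` is a linear map on the space of real symmetric `n × n`
matrices which is equivariant under the action `A ↦ D A Dᵀ` of the orthogonal group
`O(n)`, then `T A = κ • A + λ • (trace A) • 1` for some constants `κ, λ`. -/
theorem stmt_0 (n : ℕ) (hn : 1 ≤ n)
    (T : SymMat n →ₗ[ℝ] SymMat n)
    (hT : ∀ D : Matrix (Fin n) (Fin n) ℝ, D ∈ Matrix.orthogonalGroup (Fin n) ℝ →
      ∀ A B : SymMat n, (B : Matrix (Fin n) (Fin n) ℝ) = D * (A : Matrix (Fin n) (Fin n) ℝ) * Dᵀ →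
        (T B : Matrix (Fin n) (Fin n) ℝ) = D * (T A : Matrix (Fin n) (Fin n) ℝ) * Dᵀ) :
    ∃ κ lam : ℝ, ∀ A : SymMat n,
      (T A : Matrix (Fin n) (Fin n) ℝ) =
        κ • (A : Matrix (Fin n) (Fin n) ℝ) +
          lam • (Matrix.trace (A : Matrix (Fin n) (Fin n) ℝ) •
            (1 : Matrix (Fin n) (Fin n) ℝ)) := by
  obtain ⟨κ, lam, h⟩ := exists_apply_diagonalSymMat T hT
  refine ⟨κ, lam, fun A => ?_⟩
  have hA : (A : Matrix (Fin n) (Fin n) ℝ).IsHermitian := by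
    rw [Matrix.IsHermitian, Matrix.conjTranspose_eq_transpose_of_trivial]
    exact A.2
  obtain ⟨U, hU, d, hd⟩ : ∃ U ∈ Matrix.orthogonalGroup (Fin n) ℝ, ∃ d : Fin n → ℝ,
      (A : Matrix (Fin n) (Fin n) ℝ) = U * Matrix.diagonal d * Uᵀ :=
    ⟨hA.eigenvectorUnitary, hA.eigenvectorUnitary.2, hA.eigenvalues, hA.spectral_theorem⟩
  have hUU : U * Uᵀ = 1 := (Matrix.mem_orthogonalGroup_iff _ _).1 hU
  have hUU' : Uᵀ * U = 1 := (Matrix.mem_orthogonalGroup_iff' _ _).1 hU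
  have htr : Matrix.trace (A : Matrix (Fin n) (Fin n) ℝ) = ∑ i, d i := by
    rw [hd, Matrix.trace_mul_cycle, hUU', one_mul, Matrix.trace_diagonal]
  rw [hT U hU (diagonalSymMat n d) A hd, h, htr, hd]
  simp [mul_add, add_mul, hUU]
end

section
/- Let n ≥ 1, let f : ℝⁿ → ℝ be smooth and compactly supported, let Ω₀ ⊆ ℝⁿ be a bounded open set, let r ∈ ℕ and ε > 0. Then there exists a smooth compactly supported function g : ℝⁿ → ℝ such that g is real analytic on Ω₀ (i.e. analytic at every point of Ω₀) and for every i ≤ r and every x ∈ ℝⁿ one has ‖iteratedFDeriv ℝ i (f − g) x‖ ≤ ε. -/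
open MeasureTheory Set Metric FourierTransform
open scoped ContDiff

/-- The Fourier transform of an integrable function vanishing outside a closed ball is real
analytic. -/
theorem analyticAt_fourier_of_support_subset_closedBall {V : Type*} [NormedAddCommGroup V]
    [InnerProductSpace ℝ V] [FiniteDimensional ℝ V] [MeasurableSpace V] [BorelSpace V]
    {w : V → ℂ} (hw : Integrable w) {R : ℝ} (hR : Function.support w ⊆ closedBall 0 R) (x : V) :
    AnalyticAt ℝ (𝓕 w) x := by
  let K : Set V := closedBall 0 R
  have hK : MeasurableSet K := measurableSet_closedBall
  have : CompactSpace K := isCompact_iff_compactSpace.mp (isCompact_closedBall 0 R)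
  let μ : Measure K := Measure.comap Subtype.val volume
  have hwK : Integrable (fun v : K ↦ w v) μ :=
    (MeasurableEmbedding.subtype_coe hK).integrable_map_iff.mp <| by
      rw [map_comap_subtype_coe hK]
      exact hw.integrableOn
  have hint (u : C(K, ℂ)) : Integrable (fun v : K ↦ u v * w v) μ :=
    hwK.bdd_mul u.continuous.aestronglyMeasurable (.of_forall u.norm_coe_le_norm)
  let T : C(K, ℂ) →L[ℝ] ℂ := LinearMap.mkContinuous
    { toFun := fun u ↦ ∫ v : K, u v * w v ∂μ
      map_add' := fun u₁ u₂ ↦ by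
        simp only [ContinuousMap.add_apply, add_mul]
        exact integral_add (hint u₁) (hint u₂)
      map_smul' := fun c u ↦ by
        simp only [ContinuousMap.smul_apply, smul_mul_assoc, RingHom.id_apply]
        exact integral_smul c _ }
    (∫ v : K, ‖w v‖ ∂μ) <| fun u ↦ by
      refine (norm_integral_le_of_norm_le (hwK.norm.const_mul ‖u‖) (.of_forall fun v ↦ ?_)).trans ?_
      · rw [norm_mul]
        gcongr
        exact u.norm_coe_le_norm v
      · rw [integral_const_mul, mul_comm]
  let Λ : V →L[ℝ] C(K, ℂ) := LinearMap.toContinuousLinearMap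
    { toFun := fun y ↦ ⟨fun v ↦ ((-2 * Real.pi * inner ℝ (v : V) y : ℝ) : ℂ) * Complex.I,
        by fun_prop⟩
      map_add' := fun y z ↦ by
        ext v
        simp [inner_add_right]
        ring
      map_smul' := fun c y ↦ by
        ext v
        simp [inner_smul_right]
        ring }
  have key : 𝓕 w = fun y ↦ T (NormedSpace.exp (Λ y)) := by
    ext y
    rw [Real.fourier_eq']
    have h1 : T (NormedSpace.exp (Λ y)) = ∫ v : K, NormedSpace.exp (Λ y) v * w v ∂μ := rfl
    have h2 (v : K) : (NormedSpace.exp (Λ y)) v =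
        Complex.exp (((-2 * Real.pi * inner ℝ (v : V) y : ℝ) : ℂ) * Complex.I) := by
      rw [Complex.exp_eq_exp_ℂ]
      exact NormedSpace.map_exp (ContinuousMap.evalAlgHom ℝ ℂ v) (continuous_eval_const v) (Λ y)
    simp_rw [h1, h2]
    rw [integral_subtype_comap hK (fun v : V ↦
      Complex.exp (((-2 * Real.pi * inner ℝ v y : ℝ) : ℂ) * Complex.I) * w v)]
    refine (setIntegral_eq_integral_of_forall_compl_eq_zero fun v hv ↦ ?_).symm
    have : w v = 0 := by
      by_contra h
      exact hv (hR h)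
    simp [this]
  rw [key]
  exact (T.analyticAt _).comp ((NormedSpace.exp_analytic (𝕂 := ℝ) _).comp (Λ.analyticAt x))

/-- The `i`-th derivative of a Fourier transform is bounded by the `i`-th moment. -/
theorem norm_iteratedFDeriv_fourier_le_integral {V E : Type*} [NormedAddCommGroup V]
    [InnerProductSpace ℝ V] [FiniteDimensional ℝ V] [MeasurableSpace V] [BorelSpace V]
    [NormedAddCommGroup E] [NormedSpace ℂ E]
    {w : V → E} (hw : AEStronglyMeasurable w)
    (hint : ∀ k : ℕ, Integrable fun v ↦ ‖v‖ ^ k * ‖w v‖) (i : ℕ) (x : V) :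
    ‖iteratedFDeriv ℝ i (𝓕 w) x‖ ≤ (2 * Real.pi) ^ i * ∫ v, ‖v‖ ^ i * ‖w v‖ := by
  rw [Real.iteratedFDeriv_fourier (N := ⊤) (fun k _ ↦ hint k) hw (by simp), Real.fourier_eq,
    ← integral_const_mul]
  refine norm_integral_le_of_norm_le ((hint i).const_mul _) (.of_forall fun v ↦ ?_)
  rw [Circle.norm_smul]
  refine (VectorFourier.norm_fourierPowSMulRight_le _ _ _ _).trans ?_
  rw [mul_assoc]
  refine mul_le_mul_of_nonneg_right (pow_le_pow_left₀ (by positivity) ?_ i) (by positivity)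
  exact mul_le_of_le_one_right (by positivity) (norm_innerSL_le ℝ)

/-- The integral of an integrable function over the complement of a large ball is small. -/
theorem exists_setIntegral_compl_closedBall_lt {V : Type*} [NormedAddCommGroup V]
    [MeasurableSpace V] [BorelSpace V] {μ : Measure V} {h : V → ℝ} (hh : Integrable h μ)
    {δ : ℝ} (hδ : 0 < δ) : ∃ R : ℝ, ∫ v in (closedBall 0 R)ᶜ, h v ∂μ < δ := by
  have anti : Antitone fun R : ℕ ↦ (closedBall (0 : V) R)ᶜ := fun R S hRS ↦
    compl_subset_compl.mpr (closedBall_subset_closedBall (mod_cast hRS))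
  have ht := Antitone.tendsto_setIntegral (fun R : ℕ ↦ measurableSet_closedBall.compl) anti
    hh.integrableOn
  have hempty : ⋂ R : ℕ, (closedBall (0 : V) R)ᶜ = ∅ := by
    refine eq_empty_of_forall_notMem fun v hv ↦ ?_
    obtain ⟨R, hR⟩ := exists_nat_ge ‖v‖
    exact mem_iInter.mp hv R (by simpa using hR)
  rw [hempty, setIntegral_empty] at ht
  obtain ⟨R, hR⟩ := (ht.eventually_lt_const hδ).exists
  exact ⟨R, hR⟩

/-- The derivatives up to a given order of a smooth compactly supported function are uniformly
bounded. -/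
theorem exists_norm_iteratedFDeriv_le_of_hasCompactSupport {V E : Type*} [NormedAddCommGroup V]
    [NormedSpace ℝ V] [NormedAddCommGroup E] [NormedSpace ℝ E] {χ : V → E}
    (hχ : ContDiff ℝ ∞ χ) (hs : HasCompactSupport χ) (r : ℕ) :
    ∃ C : ℝ, 0 < C ∧ ∀ i ≤ r, ∀ x, ‖iteratedFDeriv ℝ i χ x‖ ≤ C := by
  have (i : ℕ) : ∃ C : ℝ, ∀ x, ‖iteratedFDeriv ℝ i χ x‖ ≤ C :=
    (hχ.continuous_iteratedFDeriv (mod_cast le_top)).bounded_above_of_compact_support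
      (hs.iteratedFDeriv i)
  choose C hC using this
  have hC0 (i : ℕ) : 0 ≤ C i := (norm_nonneg _).trans (hC i 0)
  refine ⟨1 + ∑ i ∈ Finset.range (r + 1), C i, ?_, fun i hi x ↦ (hC i x).trans ?_⟩
  · have := Finset.sum_nonneg fun i (_ : i ∈ Finset.range (r + 1)) ↦ hC0 i
    linarith
  · have := Finset.single_le_sum (fun i _ ↦ hC0 i) (Finset.mem_range_succ_iff.mpr hi)
    linarith

/-- A Schwartz function is, up to an error whose derivatives of order at most `r` are uniformly
small, the Fourier transform of an integrable function vanishing outside a ball. -/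
theorem SchwartzMap.exists_fourier_approx {V : Type*} [NormedAddCommGroup V]
    [InnerProductSpace ℝ V] [FiniteDimensional ℝ V] [MeasurableSpace V] [BorelSpace V]
    (F : SchwartzMap V ℂ) (r : ℕ) {δ : ℝ} (hδ : 0 < δ) :
    ∃ G : V → ℂ, (∀ x, AnalyticAt ℝ G x) ∧
      ∀ i ≤ r, ∀ x, ‖iteratedFDeriv ℝ i (⇑F - G) x‖ ≤ δ := by
  let w : SchwartzMap V ℂ := 𝓕⁻ F
  have hmom (k : ℕ) : Integrable fun v ↦ ‖v‖ ^ k * ‖w v‖ := w.integrable_pow_mul volume k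
  obtain ⟨R, hRδ⟩ := exists_setIntegral_compl_closedBall_lt (μ := (volume : Measure V))
    (integrable_finsetSum (Finset.range (r + 1)) fun k _ ↦
      (hmom k).const_mul ((2 * Real.pi) ^ k)) hδ
  set B : Set V := closedBall 0 R
  have hB : MeasurableSet B := measurableSet_closedBall
  have hlow : Integrable (B.indicator w) := w.integrable.indicator hB
  have hhigh : Integrable (Bᶜ.indicator w) := w.integrable.indicator hB.compl
  refine ⟨𝓕 (B.indicator w), analyticAt_fourier_of_support_subset_closedBall hlow
    Set.support_indicator_subset, fun i hi x ↦ ?_⟩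
  have hsub : ⇑F - 𝓕 (B.indicator w) = 𝓕 (Bᶜ.indicator w) := by
    have hF : ⇑F = 𝓕 (w : V → ℂ) := by
      rw [← SchwartzMap.fourier_coe, FourierTransform.fourier_fourierInv_eq]
    rw [hF, sub_eq_iff_eq_add]
    ext y
    rw [Pi.add_apply]
    simp only [Real.fourier_eq]
    rw [← integral_add]
    · refine integral_congr_ae (.of_forall fun v ↦ ?_)
      simp only
      rw [← smul_add, Set.indicator_compl_add_self_apply]
    · exact (Real.fourierIntegral_convergent_iff y).mpr hhigh
    · exact (Real.fourierIntegral_convergent_iff y).mpr hlow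
  rw [hsub]
  have heq (k : ℕ) : (fun v ↦ ‖v‖ ^ k * ‖Bᶜ.indicator w v‖) =
      Bᶜ.indicator fun v ↦ ‖v‖ ^ k * ‖w v‖ := by
    ext v
    by_cases hv : v ∈ Bᶜ
    · simp only [Set.indicator_of_mem hv]
    · simp only [Set.indicator_of_notMem hv, norm_zero, mul_zero]
  refine (norm_iteratedFDeriv_fourier_le_integral hhigh.aestronglyMeasurable
    (fun k ↦ ?_) i x).trans (le_trans ?_ hRδ.le)
  · rw [heq]
    exact (hmom k).indicator hB.compl
  · rw [heq, integral_indicator hB.compl, ← integral_const_mul]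
    refine setIntegral_mono ((hmom i).const_mul _).integrableOn
      (integrable_finsetSum _ fun k _ ↦ (hmom k).const_mul _).integrableOn fun v ↦ ?_
    exact Finset.single_le_sum (f := fun k ↦ (2 * Real.pi) ^ k * (‖v‖ ^ k * ‖w v‖))
      (fun k _ ↦ by positivity) (Finset.mem_range_succ_iff.mpr hi)


/-- Every smooth compactly supported function on `ℝⁿ` can be approximated,
together with all derivatives up to any fixed order `r`, uniformly on `ℝⁿ` to within `ε`, by a
smooth compactly supported function which is real analytic on a prescribed bounded open set. -/
theorem stmt_2 (n : ℕ) (hn : 1 ≤ n)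
    (f : EuclideanSpace ℝ (Fin n) → ℝ)
    (hf : ContDiff ℝ (⊤ : ℕ∞) f) (hfsupp : HasCompactSupport f)
    (Ω₀ : Set (EuclideanSpace ℝ (Fin n))) (hΩ₀ : IsOpen Ω₀)
    (hΩ₀b : Bornology.IsBounded Ω₀)
    (r : ℕ) (ε : ℝ) (hε : 0 < ε) :
    ∃ g : EuclideanSpace ℝ (Fin n) → ℝ,
      ContDiff ℝ (⊤ : ℕ∞) g ∧ HasCompactSupport g ∧
      (∀ x ∈ Ω₀, AnalyticAt ℝ g x) ∧
      ∀ i ≤ r, ∀ x, ‖iteratedFDeriv ℝ i (f - g) x‖ ≤ ε := by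
  obtain ⟨ρ, hρ, hsub⟩ := (hΩ₀b.union hfsupp.isCompact.isBounded).subset_closedBall_lt 0 0
  let χ : ContDiffBump (0 : EuclideanSpace ℝ (Fin n)) := ⟨ρ, ρ + 1, hρ, by linarith⟩
  have hχ1 {x : EuclideanSpace ℝ (Fin n)} (hx : x ∈ Ω₀ ∪ tsupport f) : χ x = 1 :=
    χ.one_of_mem_closedBall (hsub hx)
  have hχ : ContDiff ℝ ∞ χ := χ.contDiff
  obtain ⟨C, hC, hCχ⟩ := exists_norm_iteratedFDeriv_le_of_hasCompactSupport hχ χ.hasCompactSupport r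
  have hFsupp : HasCompactSupport fun x ↦ (f x : ℂ) :=
    hfsupp.comp_left (g := ((↑) : ℝ → ℂ)) Complex.ofReal_zero
  let F : SchwartzMap (EuclideanSpace ℝ (Fin n)) ℂ :=
    hFsupp.toSchwartzMap (Complex.ofRealCLM.contDiff.comp hf)
  obtain ⟨G, hGa, hG⟩ := F.exists_fourier_approx r (δ := ε / (2 ^ r * C)) (by positivity)
  have hGre (x) : AnalyticAt ℝ (fun y ↦ (G y).re) x := (Complex.reCLM.analyticAt _).comp (hGa x)
  have hGc : ContDiff ℝ ∞ G := contDiff_iff_contDiffAt.mpr fun x ↦ (hGa x).contDiffAt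
  have hgc : ContDiff ℝ ∞ fun x ↦ χ x * (G x).re :=
    hχ.mul (Complex.reCLM.contDiff.comp hGc)
  refine ⟨fun x ↦ χ x * (G x).re, hgc, χ.hasCompactSupport.mul_right, fun x hx ↦ ?_,
    fun i hi x ↦ ?_⟩
  · refine (hGre x).congr ?_
    filter_upwards [hΩ₀.mem_nhds hx] with y hy
    rw [hχ1 (Or.inl hy), one_mul]
  have hdiff : f - (fun x ↦ χ x * (G x).re) = fun x ↦ χ x * Complex.reCLM ((⇑F - G) x) := by
    ext y
    have hFy : F y = (f y : ℂ) := rfl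
    simp only [Pi.sub_apply, Complex.reCLM_apply, Complex.sub_re, hFy, Complex.ofReal_re]
    by_cases hy : y ∈ tsupport f
    · rw [hχ1 (Or.inr hy)]
      ring
    · rw [image_eq_zero_of_notMem_tsupport hy]
      ring
  have hFG : ContDiff ℝ ∞ (⇑F - G) := (F.smooth ⊤).sub hGc
  have hre (j : ℕ) (hj : j ≤ r) :
      ‖iteratedFDeriv ℝ j (fun y ↦ Complex.reCLM ((⇑F - G) y)) x‖ ≤ ε / (2 ^ r * C) := by
    refine (Complex.reCLM.norm_iteratedFDeriv_comp_left hFG.contDiffAt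
      (mod_cast le_top)).trans ?_
    rw [Complex.reCLM_norm, one_mul]
    exact hG j hj x
  rw [hdiff]
  refine (norm_iteratedFDeriv_mul_le hχ (Complex.reCLM.contDiff.comp hFG) x
    (mod_cast le_top)).trans ?_
  calc ∑ j ∈ Finset.range (i + 1), (i.choose j : ℝ) * ‖iteratedFDeriv ℝ j χ x‖ *
        ‖iteratedFDeriv ℝ (i - j) (fun y ↦ Complex.reCLM ((⇑F - G) y)) x‖
      ≤ ∑ j ∈ Finset.range (i + 1), (i.choose j : ℝ) * C * (ε / (2 ^ r * C)) := by
        refine Finset.sum_le_sum fun j hj ↦ ?_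
        have hji := Finset.mem_range_succ_iff.mp hj
        gcongr
        · exact hCχ j (hji.trans hi) x
        · exact hre _ ((Nat.sub_le _ _).trans hi)
    _ = 2 ^ i * (C * (ε / (2 ^ r * C))) := by
        simp_rw [mul_assoc]
        rw [← Finset.sum_mul]
        exact_mod_cast congrArg (fun m : ℕ ↦ (m : ℝ) * (C * (ε / (2 ^ r * C))))
          (Nat.sum_range_choose i)
    _ ≤ 2 ^ r * (C * (ε / (2 ^ r * C))) := by
        gcongr
        norm_num
    _ = ε := by field_simp
end

section
/- Let n ≥ 1 and let H : 𝓢(ℝⁿ, ℝ) → 𝓢(ℝⁿ, ℝ) be a continuous linear map on the real Schwartz space such that the topological support of H φ is contained in the topological support of φ for every Schwartz function φ. Then for every point x ∈ ℝⁿ there exist a natural number M and real constants c_α, indexed by multi-indices α = (α₁,…,α_n) with |α| ≤ M, such that (H φ)(x) = Σ_{|α| ≤ M} c_α (∂^α φ)(x) for every Schwartz function φ, where ∂^α φ = ∂₁^{α₁} ⋯ ∂_n^{α_n} φ denotes the iterated partial derivative. -/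
/-- The partial derivative of `f` in the `i`-th coordinate direction of `ℝⁿ`. -/
noncomputable def coordPartialDeriv (n : ℕ) (i : Fin n)
    (f : EuclideanSpace ℝ (Fin n) → ℝ) : EuclideanSpace ℝ (Fin n) → ℝ :=
  fun x => fderiv ℝ f x (EuclideanSpace.single i 1)

/-- The iterated partial derivative `∂^α f = ∂₁^{α₁} ⋯ ∂ₙ^{αₙ} f` associated to a
multi-index `α : Fin n → ℕ`. -/
noncomputable def multiPartialDeriv (n : ℕ) (α : Fin n → ℕ)
    (f : EuclideanSpace ℝ (Fin n) → ℝ) : EuclideanSpace ℝ (Fin n) → ℝ :=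
  ((List.ofFn fun i : Fin n => (coordPartialDeriv n i)^[α i]).foldr (· ∘ ·) id) f

open scoped LineDeriv SchwartzMap ContDiff

section Algebra

/-- Multiplying an ordered product of powers of commuting elements by one of these elements raises
the corresponding exponent by one. -/
theorem Commute.mul_prod_ofFn_pow {R : Type*} [Monoid R] {n : ℕ} (P : Fin n → R)
    (hP : ∀ i j, Commute (P i) (P j)) (α : Fin n → ℕ) (i : Fin n) :
    P i * (List.ofFn fun j => P j ^ α j).prod =
      (List.ofFn fun j => P j ^ (α j + (Pi.single i 1 : Fin n → ℕ) j)).prod := by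
  induction n with
  | zero => exact i.elim0
  | succ n ih =>
    simp only [List.ofFn_succ, List.prod_cons]
    refine Fin.cases ?_ (fun i => ?_) i
    · simp [← mul_assoc, pow_succ']
    · have h := ih (fun j => P j.succ) (fun _ _ => hP _ _) (fun j => α j.succ) i
      have hs (j : Fin n) : (Pi.single i.succ 1 : Fin (n + 1) → ℕ) j.succ =
          (Pi.single i 1 : Fin n → ℕ) j := by
        simp [Pi.single_apply]
      simp only [hs, ← h]
      rw [← mul_assoc, ((hP i.succ 0).pow_right _).eq, mul_assoc]
      simp

/-- A product of a list of commuting elements can be rewritten as an ordered product of powers. -/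
theorem exists_prod_map_eq_prod_ofFn_pow {R : Type*} [Monoid R] {n : ℕ} (P : Fin n → R)
    (hP : ∀ i j, Commute (P i) (P j)) (l : List (Fin n)) :
    ∃ α : Fin n → ℕ, ∑ i, α i = l.length ∧
      (l.map P).prod = (List.ofFn fun j => P j ^ α j).prod := by
  induction l with
  | nil => exact ⟨0, by simp, by simp [List.ofFn_const]⟩
  | cons i l ih =>
    obtain ⟨α, hα, h⟩ := ih
    refine ⟨α + Pi.single i 1, ?_, ?_⟩
    · simp [Finset.sum_add_distrib, hα]
    · rw [List.map_cons, List.prod_cons, h, Commute.mul_prod_ofFn_pow P hP]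
      rfl

end Algebra

namespace SchwartzMap

section PartialDerivatives

variable {n : ℕ}

theorem lineDerivOp_comm {E F : Type*} [NormedAddCommGroup E] [NormedSpace ℝ E]
    [NormedAddCommGroup F] [NormedSpace ℝ F] (v w : E) (f : 𝓢(E, F)) :
    ∂_{v} (∂_{w} f) = ∂_{w} (∂_{v} f) := by
  ext x
  have h (v w : E) : ∂_{v} (∂_{w} f) x = iteratedFDeriv ℝ 2 f x ![v, w] := by
    rw [← iteratedLineDerivOp_eq_iteratedFDeriv]
    rfl
  rw [h, h]
  have hs : IsSymmSndFDerivAt ℝ f x := (f.contDiffAt 2).isSymmSndFDerivAt (by simp)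
  have := hs v w
  simpa [iteratedFDeriv_two_apply] using this

/-- The partial derivative in the `i`-th coordinate direction on Schwartz space. -/
noncomputable def coordDeriv (i : Fin n) : Module.End ℝ 𝓢(EuclideanSpace ℝ (Fin n), ℝ) :=
  (LineDeriv.lineDerivOpCLM ℝ 𝓢(EuclideanSpace ℝ (Fin n), ℝ)
    (EuclideanSpace.single i (1 : ℝ))).toLinearMap

theorem coordDeriv_apply (i : Fin n) (φ : 𝓢(EuclideanSpace ℝ (Fin n), ℝ)) :
    coordDeriv i φ = ∂_{EuclideanSpace.single i (1 : ℝ)} φ :=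
  rfl

theorem coe_coordDeriv (i : Fin n) (φ : 𝓢(EuclideanSpace ℝ (Fin n), ℝ)) :
    ⇑(coordDeriv i φ) = coordPartialDeriv n i φ :=
  rfl

theorem commute_coordDeriv (i j : Fin n) : Commute (coordDeriv i) (coordDeriv j) :=
  LinearMap.ext fun φ => lineDerivOp_comm _ _ φ

/-- The iterated partial derivative associated to a multi-index on Schwartz space. -/
noncomputable def multiDeriv (α : Fin n → ℕ) : Module.End ℝ 𝓢(EuclideanSpace ℝ (Fin n), ℝ) :=
  (List.ofFn fun i => coordDeriv i ^ α i).prod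

theorem coe_multiDeriv (α : Fin n → ℕ) (φ : 𝓢(EuclideanSpace ℝ (Fin n), ℝ)) :
    ⇑(multiDeriv α φ) = multiPartialDeriv n α φ := by
  have hpow (i : Fin n) (m : ℕ) (ψ : 𝓢(EuclideanSpace ℝ (Fin n), ℝ)) :
      ⇑((coordDeriv i ^ m) ψ) = (coordPartialDeriv n i)^[m] ψ := by
    induction m with
    | zero => rfl
    | succ m ih =>
      rw [pow_succ', Module.End.mul_apply, coe_coordDeriv, ih, Function.iterate_succ_apply']
  unfold multiDeriv multiPartialDeriv
  rw [List.ofFn_eq_map, List.ofFn_eq_map]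
  induction List.finRange n with
  | nil => rfl
  | cons i l ih =>
    simp only [List.map_cons, List.prod_cons, Module.End.mul_apply, List.foldr_cons,
      Function.comp_apply, hpow, ih]

/-- If all partial derivatives of order `m` vanish at `x`, so does the `m`-th derivative. -/
theorem iteratedFDeriv_eq_zero_of_multiDeriv {φ : 𝓢(EuclideanSpace ℝ (Fin n), ℝ)}
    {x : EuclideanSpace ℝ (Fin n)} {m : ℕ}
    (h : ∀ α : Fin n → ℕ, ∑ i, α i = m → multiDeriv α φ x = 0) :
    iteratedFDeriv ℝ m φ x = 0 := by
  have key (k : ℕ) (v : Fin k → Fin n) (ψ : 𝓢(EuclideanSpace ℝ (Fin n), ℝ)) :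
      ∂^{fun i => EuclideanSpace.single (v i) (1 : ℝ)} ψ =
        ((List.ofFn v).map coordDeriv).prod ψ := by
    induction k with
    | zero => rfl
    | succ k ih =>
      rw [LineDeriv.iteratedLineDerivOp_succ_left, List.ofFn_succ, List.map_cons, List.prod_cons,
        Module.End.mul_apply, ← ih, coordDeriv_apply]
      rfl
  apply ContinuousMultilinearMap.toMultilinearMap_injective
  refine Module.Basis.ext_multilinear (fun _ => (EuclideanSpace.basisFun (Fin n) ℝ).toBasis)
    fun v => ?_
  obtain ⟨α, hα, hprod⟩ := exists_prod_map_eq_prod_ofFn_pow coordDeriv commute_coordDeriv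
    (List.ofFn v)
  have := h α (by simpa using hα)
  rw [multiDeriv, ← hprod, ← key, iteratedLineDerivOp_eq_iteratedFDeriv] at this
  simpa using this

end PartialDerivatives

section PointSupport

variable {E : Type*} [NormedAddCommGroup E] [NormedSpace ℝ E]

/-- If the derivatives of order at most `M` vanish at `x`, then the derivative of order `l` is
`O(r ^ (M + 1 - l))` on the ball of radius `r` around `x`. -/
theorem exists_norm_iteratedFDeriv_le_of_vanish {F : Type*} [NormedAddCommGroup F]
    [NormedSpace ℝ F] (φ : 𝓢(E, F)) (x : E) {M : ℕ}
    (h : ∀ j ≤ M, iteratedFDeriv ℝ j φ x = 0) :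
    ∃ C, 0 ≤ C ∧ ∀ d l : ℕ, l + d = M + 1 → ∀ r : ℝ, ∀ y ∈ Metric.closedBall x r,
      ‖iteratedFDeriv ℝ l φ y‖ ≤ C * r ^ d := by
  refine ⟨SchwartzMap.seminorm ℝ 0 (M + 1) φ, apply_nonneg _ _, fun d => ?_⟩
  induction d with
  | zero =>
    rintro l rfl r y -
    simpa using φ.norm_iteratedFDeriv_le_seminorm ℝ (M + 1) y
  | succ d ih =>
    intro l hl r y hy
    have hr : 0 ≤ r := dist_nonneg.trans hy
    have hmv := (convex_closedBall x r).norm_image_sub_le_of_norm_fderiv_le (𝕜 := ℝ)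
      (f := iteratedFDeriv ℝ l φ) (C := SchwartzMap.seminorm ℝ 0 (M + 1) φ * r ^ d)
      (fun z _ => ((φ.smooth (l + 1 : ℕ)).differentiable_iteratedFDeriv
        (by exact_mod_cast l.lt_succ_self)) z)
      (fun z hz => by
        rw [norm_fderiv_iteratedFDeriv]
        exact ih (l + 1) (by lia) r z hz) (Metric.mem_closedBall_self hr) hy
    rw [h l (by lia), sub_zero] at hmv
    refine hmv.trans ?_
    rw [pow_succ, ← mul_assoc]
    gcongr
    exact mem_closedBall_iff_norm.1 hy

variable [FiniteDimensional ℝ E]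

/-- A Schwartz function that vanishes to order `M` at `x` agrees near `x` with Schwartz functions
having arbitrarily small seminorms of order at most `M`. -/
theorem exists_eventuallyEq_seminorm_le_of_vanish [HasContDiffBump E] (φ : 𝓢(E, ℝ)) (x : E)
    {M : ℕ} (h : ∀ j ≤ M, iteratedFDeriv ℝ j φ x = 0) (k : ℕ) :
    ∃ C, 0 ≤ C ∧ ∀ ε : ℝ, 0 < ε → ε ≤ 1 → ∃ ψ : 𝓢(E, ℝ), (ψ =ᶠ[nhds x] φ) ∧
      ∀ k' ≤ k, ∀ m ≤ M, SchwartzMap.seminorm ℝ k' m ψ ≤ C * ε := by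
  obtain ⟨C, hC, hφ⟩ := exists_norm_iteratedFDeriv_le_of_vanish φ x h
  let f : ContDiffBump (0 : E) := ⟨1, 2, one_pos, one_lt_two⟩
  let B (i : ℕ) : ℝ :=
    SchwartzMap.seminorm ℝ 0 i (f.hasCompactSupport.toSchwartzMap f.contDiff : 𝓢(E, ℝ))
  have hB0 (i : ℕ) : 0 ≤ B i := apply_nonneg _ _
  have hB (i : ℕ) (z : E) : ‖iteratedFDeriv ℝ i f z‖ ≤ B i :=
    norm_iteratedFDeriv_le_seminorm ℝ
      (f.hasCompactSupport.toSchwartzMap f.contDiff : 𝓢(E, ℝ)) i z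
  let K (m : ℕ) : ℝ := ∑ i ∈ Finset.range (m + 1), m.choose i * B i * (C * 2 ^ (M + 1))
  have hK (m : ℕ) : 0 ≤ K m := Finset.sum_nonneg fun i _ => by have := hB0 i; positivity
  have hK' : 0 ≤ ∑ m ∈ Finset.range (M + 1), K m := Finset.sum_nonneg fun i _ => hK i
  refine ⟨(‖x‖ + 2) ^ k * ∑ m ∈ Finset.range (M + 1), K m, by positivity, fun ε hε hε1 => ?_⟩
  let χ : E → ℝ := fun y => f (ε⁻¹ • (y - x))
  have hχ : ContDiff ℝ ∞ χ := f.contDiff.comp (contDiff_const.smul (contDiff_id.sub contDiff_const))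
  have hχD (i : ℕ) (y : E) : ‖iteratedFDeriv ℝ i χ y‖ ≤ ε⁻¹ ^ i * B i := by
    have : iteratedFDeriv ℝ i χ y = ε⁻¹ ^ i • iteratedFDeriv ℝ i f (ε⁻¹ • (y - x)) := by
      rw [iteratedFDeriv_comp_sub (f := fun z => f (ε⁻¹ • z)),
        iteratedFDeriv_comp_const_smul _ f.contDiff]
    rw [this, norm_smul, Real.norm_of_nonneg (by positivity)]
    gcongr
    exact hB i _
  have hψ0 (y : E) (hy : y ∉ Metric.closedBall x (2 * ε)) : χ y * φ y = 0 := by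
    rw [Metric.mem_closedBall, not_le, dist_eq_norm] at hy
    have : χ y = 0 := f.zero_of_le_dist <| by
      rw [dist_zero_right, norm_smul, Real.norm_of_nonneg (by positivity), inv_mul_eq_div,
        le_div_iff₀ hε]
      exact hy.le
    rw [this, zero_mul]
  let ψ : 𝓢(E, ℝ) := (HasCompactSupport.intro (isCompact_closedBall x (2 * ε))
    hψ0).toSchwartzMap (hχ.mul (φ.smooth ⊤))
  have hψ : ⇑ψ = fun y => χ y * φ y := rfl
  refine ⟨ψ, ?_, fun k' hk' m hm => ?_⟩
  · filter_upwards [Metric.closedBall_mem_nhds x hε] with y hy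
    have : χ y = 1 := f.one_of_mem_closedBall <| by
      rw [mem_closedBall_iff_norm] at hy
      rw [mem_closedBall_zero_iff, norm_smul, Real.norm_of_nonneg (by positivity), inv_mul_eq_div,
        div_le_iff₀ hε]
      simpa [f] using hy
    rw [hψ]
    simp [this]
  refine SchwartzMap.seminorm_le_bound ℝ _ _ _ (by positivity) fun y => ?_
  by_cases hy : y ∈ Metric.closedBall x (2 * ε)
  · have hD : ‖iteratedFDeriv ℝ m ψ y‖ ≤ K m * ε := by
      rw [hψ]
      refine (norm_iteratedFDeriv_mul_le hχ (φ.smooth ⊤) y (n := m)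
        (by exact_mod_cast le_top)).trans ?_
      rw [Finset.sum_mul]
      refine Finset.sum_le_sum fun i hi => ?_
      have hi' : i ≤ m := Nat.lt_succ_iff.1 (Finset.mem_range.1 hi)
      have h1 := hφ (M + 1 - m + i) (m - i) (by lia) (2 * ε) y hy
      have h2 : ε⁻¹ ^ i * (2 * ε) ^ (M + 1 - m + i) ≤ 2 ^ (M + 1) * ε := by
        have : ε⁻¹ ^ i * (2 * ε) ^ (M + 1 - m + i) =
            2 ^ (M + 1 - m + i) * ε ^ (M + 1 - m) := by
          rw [mul_pow, pow_add ε]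
          field_simp
          rw [← mul_pow, one_div_mul_cancel hε.ne', one_pow]
        rw [this]
        exact mul_le_mul (pow_le_pow_right₀ one_le_two (by lia))
          (pow_le_of_le_one hε.le hε1 (by lia)) (by positivity) (by positivity)
      calc (m.choose i : ℝ) * ‖iteratedFDeriv ℝ i χ y‖ * ‖iteratedFDeriv ℝ (m - i) φ y‖
          ≤ m.choose i * (ε⁻¹ ^ i * B i) * (C * (2 * ε) ^ (M + 1 - m + i)) := by
            have := hB0 i
            gcongr
            exact hχD i y
        _ = m.choose i * B i * C * (ε⁻¹ ^ i * (2 * ε) ^ (M + 1 - m + i)) := by ring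
        _ ≤ m.choose i * B i * C * (2 ^ (M + 1) * ε) := by
            have := hB0 i
            gcongr
        _ = m.choose i * B i * (C * 2 ^ (M + 1)) * ε := by ring
    have hnorm : ‖y‖ ≤ ‖x‖ + 2 := by
      have h1 := norm_le_norm_add_norm_sub' y x
      have h2 := mem_closedBall_iff_norm.1 hy
      linarith
    calc ‖y‖ ^ k' * ‖iteratedFDeriv ℝ m ψ y‖ ≤ (‖x‖ + 2) ^ k' * (K m * ε) := by gcongr
      _ ≤ (‖x‖ + 2) ^ k * ((∑ m ∈ Finset.range (M + 1), K m) * ε) := by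
        gcongr
        · linarith [norm_nonneg x]
        · exact Finset.single_le_sum (f := K) (fun i _ => hK i)
            (Finset.mem_range.2 (Nat.lt_succ_of_le hm))
      _ = _ := by ring
  · have hsub : tsupport ψ ⊆ Metric.closedBall x (2 * ε) :=
      closure_minimal (fun z hz => by_contra fun hz' => hz (hψ0 z hz')) Metric.isClosed_closedBall
    have : iteratedFDeriv ℝ m ψ y = 0 :=
      by_contra fun hne => hy (hsub (support_iteratedFDeriv_subset m hne))
    rw [this, norm_zero, mul_zero]
    positivity

/-- A continuous linear functional on Schwartz space supported at a point only depends on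
finitely many derivatives at that point. -/
theorem exists_order_of_support_point [HasContDiffBump E] (T : 𝓢(E, ℝ) →L[ℝ] ℝ) (x : E)
    (hT : ∀ φ : 𝓢(E, ℝ), x ∉ tsupport φ → T φ = 0) :
    ∃ M : ℕ, ∀ φ : 𝓢(E, ℝ), (∀ j ≤ M, iteratedFDeriv ℝ j φ x = 0) → T φ = 0 := by
  obtain ⟨s, C, -, hs⟩ := Seminorm.bound_of_continuous (schwartz_withSeminorms ℝ E ℝ)
    ((normSeminorm ℝ ℝ).comp T.toLinearMap) (continuous_norm.comp T.continuous)
  refine ⟨s.sup Prod.snd, fun φ hφ => ?_⟩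
  obtain ⟨K, hK, hψ⟩ := exists_eventuallyEq_seminorm_le_of_vanish φ x hφ (s.sup Prod.fst)
  have hbound : ∀ᶠ ε in nhdsWithin (0 : ℝ) (Set.Ioi 0), ‖T φ‖ ≤ C * (K * ε) := by
    filter_upwards [Ioc_mem_nhdsGT zero_lt_one] with ε hε
    obtain ⟨ψ, hψφ, hψK⟩ := hψ ε hε.1 hε.2
    have hsub : T (φ - ψ) = 0 := hT _ <| by
      rw [notMem_tsupport_iff_eventuallyEq]
      filter_upwards [hψφ] with y hy
      simp [hy]
    rw [map_sub, sub_eq_zero] at hsub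
    rw [hsub]
    refine (hs ψ).trans ?_
    rw [smul_apply, NNReal.smul_def, smul_eq_mul]
    gcongr
    refine Seminorm.finset_sup_apply_le (by have := hε.1; positivity) fun p hp => ?_
    exact hψK _ (Finset.le_sup (f := Prod.fst) hp) _ (Finset.le_sup (f := Prod.snd) hp)
  have hlim : Filter.Tendsto (fun ε : ℝ => C * (K * ε)) (nhdsWithin 0 (Set.Ioi 0)) (nhds 0) := by
    refine tendsto_nhdsWithin_of_tendsto_nhds ?_
    have : Continuous fun ε : ℝ => C * (K * ε) := by fun_prop
    simpa using this.tendsto 0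
  exact norm_le_zero_iff.1 (ge_of_tendsto hlim hbound)

end PointSupport

end SchwartzMap

/-- A continuous linear operator on Schwartz space which does not increase
topological supports is, at each point `x`, given by a finite linear combination of iterated
partial derivatives of its argument evaluated at `x`. -/
theorem stmt_3 (n : ℕ) (hn : 1 ≤ n)
    (H : SchwartzMap (EuclideanSpace ℝ (Fin n)) ℝ →L[ℝ]
      SchwartzMap (EuclideanSpace ℝ (Fin n)) ℝ)
    (hsupp : ∀ φ : SchwartzMap (EuclideanSpace ℝ (Fin n)) ℝ,
      tsupport (H φ : EuclideanSpace ℝ (Fin n) → ℝ) ⊆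
        tsupport (φ : EuclideanSpace ℝ (Fin n) → ℝ)) :
    ∀ x : EuclideanSpace ℝ (Fin n), ∃ (M : ℕ) (c : (Fin n → ℕ) → ℝ),
      ∀ φ : SchwartzMap (EuclideanSpace ℝ (Fin n)) ℝ,
        H φ x = ∑ α ∈ (Finset.Iic fun _ : Fin n => M).filter (fun α => ∑ i, α i ≤ M),
          c α * multiPartialDeriv n α (φ : EuclideanSpace ℝ (Fin n) → ℝ) x := by
  intro x
  let T : SchwartzMap (EuclideanSpace ℝ (Fin n)) ℝ →L[ℝ] ℝ :=
    (BoundedContinuousFunction.evalCLM ℝ x).comp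
      ((SchwartzMap.toBoundedContinuousFunctionCLM ℝ (EuclideanSpace ℝ (Fin n)) ℝ).comp H)
  have hT (φ : SchwartzMap (EuclideanSpace ℝ (Fin n)) ℝ) : T φ = H φ x := rfl
  obtain ⟨M, hM⟩ := SchwartzMap.exists_order_of_support_point T x fun φ hx =>
    show H φ x = 0 from image_eq_zero_of_notMem_tsupport fun hx' => hx (hsupp φ hx')
  let s := (Finset.Iic fun _ : Fin n => M).filter (fun α => ∑ i, α i ≤ M)
  let δ : SchwartzMap (EuclideanSpace ℝ (Fin n)) ℝ →ₗ[ℝ] ℝ :=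
    { toFun φ := φ x
      map_add' _ _ := rfl
      map_smul' _ _ := rfl }
  have hspan : T.toLinearMap ∈ Submodule.span ℝ
      (Set.range fun α : s => δ ∘ₗ SchwartzMap.multiDeriv (α : Fin n → ℕ)) := by
    refine mem_span_of_iInf_ker_le_ker fun φ hφ => hM φ fun j hj => ?_
    refine SchwartzMap.iteratedFDeriv_eq_zero_of_multiDeriv fun α hα => ?_
    have hαs : α ∈ s := by
      have hsum : ∑ i, α i ≤ M := hα.trans_le hj
      refine Finset.mem_filter.2 ⟨Finset.mem_Iic.2 fun i => ?_, hsum⟩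
      exact (Finset.single_le_sum (fun _ _ => Nat.zero_le _) (Finset.mem_univ i)).trans hsum
    exact (Submodule.mem_iInf _).1 hφ ⟨α, hαs⟩
  obtain ⟨c, hc⟩ := (Submodule.mem_span_range_iff_exists_fun ℝ).1 hspan
  refine ⟨M, fun α => if h : α ∈ s then c ⟨α, h⟩ else 0, fun φ => ?_⟩
  have hφ := LinearMap.congr_fun hc φ
  rw [LinearMap.sum_apply] at hφ
  rw [← hT]
  refine hφ.symm.trans ?_
  change _ = ∑ α ∈ s, _
  rw [← Finset.sum_coe_sort s]
  refine Finset.sum_congr rfl fun α _ => ?_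
  beta_reduce
  rw [dif_pos α.2, ← SchwartzMap.coe_multiDeriv]
  rfl
end

section
/- Let n ≥ 3, let Ω ⊆ ℝⁿ be a bounded open set, and let f : ℝⁿ → ℝ be integrable on Ω. Suppose that ∫_Ω f(x) · (Σ_{i,j} (q x i j)²) dx = 0 for every smooth map q : ℝⁿ → Matrix (Fin n) (Fin n) ℝ such that for all x ∈ ℝⁿ: q x is a symmetric matrix, the trace of q x is zero, and q is divergence-free at x, i.e. Σ_i ∂_i (q · i j)(x) = 0 for every j (where ∂_i denotes the partial derivative in the i-th coordinate direction). Then f = 0 almost everywhere on Ω. -/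
open MeasureTheory

/-- If `3 ≤ n`, every vector of `ℝⁿ` is orthogonal to some orthonormal pair. -/
theorem EuclideanSpace.exists_orthonormal_pair_orthogonal {n : ℕ} (hn : 3 ≤ n)
    (k : EuclideanSpace ℝ (Fin n)) :
    ∃ m p : EuclideanSpace ℝ (Fin n), ∑ i, m i * m i = 1 ∧ ∑ i, p i * p i = 1 ∧
      ∑ i, m i * p i = 0 ∧ ∑ i, k i * m i = 0 ∧ ∑ i, k i * p i = 0 := by
  have hdim : 2 ≤ Module.finrank ℝ (ℝ ∙ k)ᗮ := by
    have h1 := Submodule.finrank_add_finrank_orthogonal (ℝ ∙ k)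
    have h2 : Module.finrank ℝ (ℝ ∙ k) ≤ 1 := by
      simpa using finrank_span_le_card (R := ℝ) ({k} : Set (EuclideanSpace ℝ (Fin n)))
    rw [finrank_euclideanSpace_fin] at h1
    omega
  let b := stdOrthonormalBasis ℝ (ℝ ∙ k)ᗮ
  have inner_eq (x y : EuclideanSpace ℝ (Fin n)) : ∑ i, x i * y i = inner ℝ x y := by
    simp [PiLp.inner_apply, mul_comm]
  have hb (i j) : inner ℝ (b i : EuclideanSpace ℝ (Fin n)) (b j) = if i = j then 1 else 0 :=
    orthonormal_iff_ite.mp b.orthonormal i j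
  simp only [inner_eq]
  refine ⟨b ⟨0, by omega⟩, b ⟨1, by omega⟩, ?_, ?_, ?_, ?_, ?_⟩
  · rw [hb, if_pos rfl]
  · rw [hb, if_pos rfl]
  · rw [hb, if_neg (by simp)]
  · exact Submodule.mem_orthogonal_singleton_iff_inner_right.mp (b ⟨0, by omega⟩).2
  · exact Submodule.mem_orthogonal_singleton_iff_inner_right.mp (b ⟨1, by omega⟩).2

/-- If `3 ≤ n`, every vector of `ℝⁿ` is in the kernel of a symmetric traceless matrix whose
entries have squares summing to `2`. -/
theorem Matrix.exists_isSymm_trace_eq_zero_sum_mul_eq_zero {n : ℕ} (hn : 3 ≤ n)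
    (k : EuclideanSpace ℝ (Fin n)) :
    ∃ C : Matrix (Fin n) (Fin n) ℝ, C.IsSymm ∧ C.trace = 0 ∧ (∀ j, ∑ i, k i * C i j = 0) ∧
      ∑ i, ∑ j, C i j ^ 2 = 2 := by
  obtain ⟨m, p, hm, hp, hmp, hkm, hkp⟩ :=
    EuclideanSpace.exists_orthonormal_pair_orthogonal hn k
  refine ⟨Matrix.of fun i j => m i * m j - p i * p j, ?_, ?_, fun j => ?_, ?_⟩
  · ext i j
    simp [mul_comm]
  · simp [Matrix.trace, Finset.sum_sub_distrib, hm, hp]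
  · calc ∑ i, k i * (m i * m j - p i * p j)
        = (∑ i, k i * m i) * m j - (∑ i, k i * p i) * p j := by
          simp only [Finset.sum_mul, ← Finset.sum_sub_distrib]
          exact Finset.sum_congr rfl fun i _ => by ring
      _ = 0 := by simp [hkm, hkp]
  · calc ∑ i, ∑ j, (m i * m j - p i * p j) ^ 2
        = (∑ i, m i * m i) * (∑ j, m j * m j) - 2 * ((∑ i, m i * p i) * ∑ j, m j * p j)
            + (∑ i, p i * p i) * ∑ j, p j * p j := by
          simp only [Finset.sum_mul_sum]
          simp only [Finset.mul_sum, ← Finset.sum_sub_distrib,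
            ← Finset.sum_add_distrib]
          exact Finset.sum_congr rfl fun i _ => Finset.sum_congr rfl fun j _ => by ring
      _ = 2 := by rw [hm, hp, hmp]; norm_num

/-- A continuous function on a compact set of an inner product space is uniformly approximated
there by continuous functions in any linear subspace containing all exponentials. -/
theorem IsCompact.exists_mem_norm_sub_lt_of_exp_inner_mem {E : Type*} [NormedAddCommGroup E]
    [InnerProductSpace ℝ E] {K : Set E} (hK : IsCompact K) (V : Submodule ℝ C(E, ℝ))
    (hV : ∀ k : E, (⟨fun x => Real.exp (inner ℝ k x), by fun_prop⟩ : C(E, ℝ)) ∈ V)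
    (g : C(E, ℝ)) {ε : ℝ} (hε : 0 < ε) : ∃ P ∈ V, ∀ x ∈ K, ‖g x - P x‖ < ε := by
  have : CompactSpace K := isCompact_iff_compactSpace.mp hK
  let e : Multiplicative E →* C(K, ℝ) :=
    { toFun := fun k => ⟨fun x => Real.exp (inner ℝ k.toAdd (x : E)), by fun_prop⟩
      map_one' := by ext x; simp
      map_mul' := fun k l => by ext x; simp [inner_add_left, Real.exp_add] }
  let A : Subalgebra ℝ C(K, ℝ) := Algebra.adjoin ℝ (MonoidHom.mrange e : Set C(K, ℝ))
  have hA : A.SeparatesPoints := by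
    intro x y hxy
    refine ⟨e (Multiplicative.ofAdd ((x : E) - y)), ⟨e (Multiplicative.ofAdd ((x : E) - y)),
      Algebra.subset_adjoin ⟨_, rfl⟩, rfl⟩, fun h => hxy ?_⟩
    have h' := Real.exp_injective h
    have h0 : inner ℝ ((x : E) - y) ((x : E) - y) = 0 := by
      rw [inner_sub_right]
      exact sub_eq_zero.mpr h'
    exact Subtype.ext (sub_eq_zero.mp (inner_self_eq_zero.mp h0))
  obtain ⟨p, hp⟩ := ContinuousMap.exists_mem_subalgebra_near_continuousMap_of_separatesPoints A hA
    (g.restrict K) ε hε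
  have hspan : (p : C(K, ℝ)) ∈ Submodule.span ℝ (MonoidHom.mrange e : Set C(K, ℝ)) := by
    have h := p.2
    rwa [← Subalgebra.mem_toSubmodule, Algebra.adjoin_eq_span, Submonoid.closure_eq] at h
  have hext : ∃ P ∈ V, P.restrict K = (p : C(K, ℝ)) := by
    generalize (p : C(K, ℝ)) = a at hspan
    induction hspan using Submodule.span_induction with
    | mem h hh =>
      obtain ⟨k, rfl⟩ := hh
      exact ⟨_, hV k.toAdd, rfl⟩
    | zero => exact ⟨0, V.zero_mem, rfl⟩
    | add a b _ _ ha hb =>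
      obtain ⟨P, hP, rfl⟩ := ha
      obtain ⟨Q, hQ, rfl⟩ := hb
      exact ⟨P + Q, V.add_mem hP hQ, rfl⟩
    | smul c a _ ha =>
      obtain ⟨P, hP, rfl⟩ := ha
      exact ⟨c • P, V.smul_mem c hP, rfl⟩
  obtain ⟨P, hP, hPp⟩ := hext
  refine ⟨P, hP, fun x hx => ?_⟩
  have h := (ContinuousMap.norm_coe_le_norm ((p : C(K, ℝ)) - g.restrict K) ⟨x, hx⟩).trans_lt hp
  rw [← hPp] at h
  rw [norm_sub_rev]
  exact h

/-- An integrable function on a bounded open set whose Laplace transform vanishes identically is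
almost everywhere zero. -/
theorem MeasureTheory.ae_eq_zero_of_setIntegral_mul_exp_inner_eq_zero {E : Type*}
    [NormedAddCommGroup E] [InnerProductSpace ℝ E] [FiniteDimensional ℝ E] [MeasurableSpace E]
    [BorelSpace E] {μ : Measure E} {Ω : Set E} (hopen : IsOpen Ω)
    (hbdd : Bornology.IsBounded Ω) {f : E → ℝ} (hf : IntegrableOn f Ω μ)
    (h : ∀ k : E, ∫ x in Ω, f x * Real.exp (inner ℝ k x) ∂μ = 0) :
    f =ᵐ[μ.restrict Ω] 0 := by
  have hK : IsCompact (closure Ω) := hbdd.isCompact_closure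
  have hint (P : C(E, ℝ)) : IntegrableOn (fun x => f x * P x) Ω μ := by
    obtain ⟨c, hc⟩ := hK.exists_bound_of_continuousOn P.continuous.continuousOn
    exact Integrable.mul_bdd (c := c) hf P.continuous.aestronglyMeasurable
      ((ae_restrict_iff' hopen.measurableSet).mpr
        (Filter.Eventually.of_forall fun x hx => hc x (subset_closure hx)))
  let V : Submodule ℝ C(E, ℝ) :=
    { carrier := {P | ∫ x in Ω, f x * P x ∂μ = 0}
      zero_mem' := by simp
      add_mem' := fun {P Q} hP hQ => by
        simp only [Set.mem_ofPred_eq, ContinuousMap.add_apply, mul_add] at hP hQ ⊢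
        rw [integral_add (hint P) (hint Q), hP, hQ, add_zero]
      smul_mem' := fun c P hP => by
        simp only [Set.mem_ofPred_eq, ContinuousMap.smul_apply, smul_eq_mul,
          mul_left_comm _ c] at hP ⊢
        rw [integral_const_mul, hP, mul_zero] }
  have hzero (g : C(E, ℝ)) : ∫ x in Ω, f x * g x ∂μ = 0 := by
    have hle (ε : ℝ) (hε : 0 < ε) :
        ‖∫ x in Ω, f x * g x ∂μ‖ ≤ (∫ x in Ω, ‖f x‖ ∂μ) * ε := by
      obtain ⟨P, hP, hPg⟩ := hK.exists_mem_norm_sub_lt_of_exp_inner_mem V h g hε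
      have hP' : ∫ x in Ω, f x * P x ∂μ = 0 := hP
      rw [← sub_zero (∫ x in Ω, f x * g x ∂μ), ← hP', ← integral_sub (hint g) (hint P),
        ← integral_mul_const]
      refine norm_integral_le_of_norm_le (hf.norm.mul_const ε)
        ((ae_restrict_iff' hopen.measurableSet).mpr (Filter.Eventually.of_forall fun x hx => ?_))
      rw [← mul_sub, norm_mul]
      exact mul_le_mul_of_nonneg_left (hPg x (subset_closure hx)).le (norm_nonneg _)
    have hlim : Filter.Tendsto (fun ε : ℝ => (∫ x in Ω, ‖f x‖ ∂μ) * ε)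
        (nhdsWithin 0 (Set.Ioi 0)) (nhds 0) := by
      have hc : Continuous fun ε : ℝ => (∫ x in Ω, ‖f x‖ ∂μ) * ε := by fun_prop
      simpa using (hc.tendsto 0).mono_left nhdsWithin_le_nhds
    exact norm_le_zero_iff.mp (ge_of_tendsto hlim (eventually_mem_nhdsWithin.mono hle))
  refine (ae_restrict_iff' hopen.measurableSet).mpr ?_
  refine hopen.ae_eq_zero_of_integral_contDiff_smul_eq_zero hf.locallyIntegrableOn
    fun g hg _ hsupp => ?_
  rw [← hzero ⟨g, hg.continuous⟩, ← setIntegral_eq_integral_of_forall_compl_eq_zero (s := Ω)]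
  · simp [mul_comm]
  · intro x hx
    rw [image_eq_zero_of_notMem_tsupport fun hx' => hx (hsupp hx'), zero_smul]



/-- (Flat-space Lemma D.2(a).) Let `n ≥ 3`, `Ω ⊆ ℝⁿ` bounded open, and `f`
integrable on `Ω`. If `∫_Ω f · Σᵢⱼ qᵢⱼ² = 0` for every smooth transverse traceless symmetric
matrix field `q` on `ℝⁿ`, then `f = 0` a.e. on `Ω`. -/
theorem stmt_7 (n : ℕ) (hn : 3 ≤ n)
    (Ω : Set (EuclideanSpace ℝ (Fin n))) (hopen : IsOpen Ω)
    (hbdd : Bornology.IsBounded Ω)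
    (f : EuclideanSpace ℝ (Fin n) → ℝ) (hf : IntegrableOn f Ω)
    (horth : ∀ q : EuclideanSpace ℝ (Fin n) → Matrix (Fin n) (Fin n) ℝ,
      (∀ i j, ContDiff ℝ (⊤ : ℕ∞) fun x => q x i j) →
      (∀ x, (q x).IsSymm) →
      (∀ x, (q x).trace = 0) →
      (∀ x j, ∑ i, fderiv ℝ (fun y => q y i j) x (EuclideanSpace.single i 1) = 0) →
      ∫ x in Ω, f x * ∑ i, ∑ j, (q x i j) ^ 2 = 0) :
    f =ᵐ[volume.restrict Ω] 0 := by
  refine ae_eq_zero_of_setIntegral_mul_exp_inner_eq_zero hopen hbdd hf fun k => ?_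
  obtain ⟨C, hsymm, htrace, hker, hsq⟩ :=
    Matrix.exists_isSymm_trace_eq_zero_sum_mul_eq_zero hn ((1 / 2 : ℝ) • k)
  set l : EuclideanSpace ℝ (Fin n) := (1 / 2 : ℝ) • k with hl
  have h := horth (fun x => Real.exp (inner ℝ l x) • C) (fun i j => ?_)
    (fun x => hsymm.smul _) (fun x => by simp [htrace]) (fun x j => ?_)
  · have hpt (x : EuclideanSpace ℝ (Fin n)) :
        f x * ∑ i, ∑ j, ((Real.exp (inner ℝ l x) • C) i j) ^ 2
          = 2 * (f x * Real.exp (inner ℝ k x)) := by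
      have hexp : Real.exp (inner ℝ l x) ^ 2 = Real.exp (inner ℝ k x) := by
        rw [← Real.exp_nat_mul, hl, real_inner_smul_left]
        congr 1
        push_cast
        ring
      simp only [Matrix.smul_apply, smul_eq_mul, mul_pow, ← Finset.mul_sum, hsq, hexp]
      ring
    simp only [hpt, integral_const_mul] at h
    exact (mul_eq_zero.mp h).resolve_left two_ne_zero
  · simp only [Matrix.smul_apply, smul_eq_mul]
    exact (contDiff_const.inner ℝ contDiff_id).exp.mul contDiff_const
  · have hderiv (i : Fin n) :
        fderiv ℝ (fun y => (Real.exp (inner ℝ l y) • C) i j) x (EuclideanSpace.single i 1)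
          = Real.exp (inner ℝ l x) * (l i * C i j) := by
      have hd : HasFDerivAt (fun y => Real.exp (inner ℝ l y) * C i j)
          (C i j • Real.exp (inner ℝ l x) • innerSL ℝ l) x :=
        ((innerSL ℝ l).hasFDerivAt.exp).mul_const (C i j)
      simp only [Matrix.smul_apply, smul_eq_mul]
      rw [hd.fderiv]
      simp [EuclideanSpace.inner_single_right]
      ring
    simp only [hderiv, ← Finset.mul_sum, hker, mul_zero]
end
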